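/- Let Ω ⊊ ℝ be a nonempty bounded convex open set (i.e., a nonempty bounded open interval). Then for every s ∈ (0,1), 𝔥_{s,1}(Ω) = 2^{2−s}/s; equivalently, 𝔥_{s,1}(Ω) = 2^{−s}·𝔥_{s,1}(ℍ^1_+). -/

import Mathlib

open MeasureTheory Metric Set Filter
open scoped ENNReal NNReal

/-- The `p`-th power of the Gagliardo `(s,p)`-seminorm of `u : ℝ → ℝ` on `A ⊆ ℝ`,
valued in `[0,∞]`. -/
noncomputable def gagliardo1 (s p : ℝ) (A : Set ℝ) (u : ℝ → ℝ) : ℝ≥0∞ :=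
  ∫⁻ x in A, ∫⁻ y in A, ENNReal.ofReal (|u x - u y| ^ p / |x - y| ^ (1 + s * p))

/-- The sharp fractional Hardy constant `𝔥_{s,p}(Ω)` for `Ω ⊆ ℝ`, an element of `[0,∞]`. -/
noncomputable def hardyConst1 (s p : ℝ) (Ω : Set ℝ) : ℝ≥0∞ :=
  sInf { c : ℝ≥0∞ | ∃ u : ℝ → ℝ,
    ContDiff ℝ (⊤ : ℕ∞) u ∧ HasCompactSupport u ∧ tsupport u ⊆ Ω ∧
    (∫ x in Ω, |u x| ^ p / Metric.infDist x (frontier Ω) ^ (s * p)) = 1 ∧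
    c = gagliardo1 s p Set.univ u }


lemma lint_Ioo {g g' : ℝ → ℝ} {a b : ℝ} (hab : a ≤ b) (hc : ContinuousOn g (Icc a b))
    (hd : ∀ x ∈ Ioo a b, HasDerivAt g (g' x) x) (hp : ∀ x ∈ Ioo a b, 0 ≤ g' x) :
    ∫⁻ x in Ioo a b, ENNReal.ofReal (g' x) = ENNReal.ofReal (g b - g a) := by
  have hi := intervalIntegral.integrableOn_deriv_of_nonneg hc hd hp
  have h2 := intervalIntegral.integral_eq_sub_of_hasDerivAt_of_le hab hc hd
    ((intervalIntegrable_iff_integrableOn_Ioc_of_le hab).2 hi)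
  rw [← h2, intervalIntegral.integral_of_le hab, integral_Ioc_eq_integral_Ioo,
    ofReal_integral_eq_lintegral_ofReal (hi.mono_set Ioo_subset_Ioc_self)]
  exact (ae_restrict_iff' measurableSet_Ioo).2 (ae_of_all _ hp)

lemma lint_Ioi {g g' : ℝ → ℝ} {a l : ℝ} (hd : ∀ x ∈ Ici a, HasDerivAt g (g' x) x)
    (hp : ∀ x ∈ Ioi a, 0 ≤ g' x) (hl : Tendsto g atTop (nhds l)) :
    ∫⁻ x in Ioi a, ENNReal.ofReal (g' x) = ENNReal.ofReal (l - g a) := by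
  have hi := integrableOn_Ioi_deriv_of_nonneg' hd hp hl
  rw [← integral_Ioi_of_hasDerivAt_of_nonneg' hd hp hl,
    ofReal_integral_eq_lintegral_ofReal hi]
  exact (ae_restrict_iff' measurableSet_Ioi).2 (ae_of_all _ hp)

noncomputable def kk (s h : ℝ) : ℝ≥0∞ := ENNReal.ofReal (|h| ^ (-(1 + s)))

lemma kk_neg (s h : ℝ) : kk s (-h) = kk s h := by simp [kk]

lemma kk_meas (s : ℝ) : Measurable (kk s) := by unfold kk; fun_prop

lemma kk_pos {s h : ℝ} (hh : 0 < h) : kk s h = ENNReal.ofReal (h ^ (-(1 + s))) := by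
  rw [kk, abs_of_pos hh]

lemma hasDeriv_tail {s x c : ℝ} (hs : 0 < s) (hx : 0 < x + c) :
    HasDerivAt (fun y => -((y + c) ^ (-s) / s)) ((x + c) ^ (-(1 + s))) x := by
  have h1 := (((hasDerivAt_id x).add_const c).rpow_const (p := -s) (Or.inl hx.ne')).div_const s |>.neg
  refine h1.congr_deriv ?_
  have : -s - 1 = -(1 + s) := by ring
  rw [this]
  simp only [id]
  field_simp

lemma lint_tail {s a c : ℝ} (hs : 0 < s) (ha : 0 < a + c) :
    ∫⁻ x in Ioi a, kk s (x + c) = ENNReal.ofReal ((a + c) ^ (-s) / s) := by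
  have h : ∫⁻ x in Ioi a, ENNReal.ofReal ((x + c) ^ (-(1 + s))) =
      ENNReal.ofReal (0 - (-((a + c) ^ (-s) / s))) := by
    refine lint_Ioi (g := fun y => -((y + c) ^ (-s) / s)) (fun x hx => hasDeriv_tail hs ?_) ?_ ?_
    · have := mem_Ici.1 hx; linarith
    · intro x hx; have := mem_Ioi.1 hx; exact Real.rpow_nonneg (by linarith) _
    · have h1 : Tendsto (fun y : ℝ => y + c) atTop atTop := tendsto_atTop_add_const_right _ _ tendsto_id
      have h2 := ((tendsto_rpow_neg_atTop hs).comp h1).div_const s |>.neg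
      simpa using h2
  rw [zero_sub, neg_neg] at h
  rw [← h]
  refine setLIntegral_congr_fun measurableSet_Ioi fun x hx => ?_
  have := mem_Ioi.1 hx
  exact kk_pos (by linarith)

lemma fold (f : ℝ → ℝ≥0∞) (hf : Measurable f) :
    ∫⁻ x, f x = ∫⁻ x in Ioi 0, (f x + f (-x)) := by
  have h1 : ∫⁻ x in Ioi (0:ℝ), f (-x) = ∫⁻ x in Iio 0, f x := by
    have := (Measure.measurePreserving_neg (volume : Measure ℝ)).setLIntegral_comp_preimage_emb
      (MeasurableEquiv.neg ℝ).measurableEmbedding f (Iio 0)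
    simpa using this
  rw [lintegral_add_left hf, h1, ← lintegral_add_compl f (measurableSet_Ioi (a := (0:ℝ))),
    compl_Ioi, setLIntegral_congr Iio_ae_eq_Iic]

lemma gag_eq {s : ℝ} (u : ℝ → ℝ) :
    gagliardo1 s 1 univ u = ∫⁻ x, ∫⁻ y, ENNReal.ofReal |u x - u y| * kk s (x - y) := by
  simp only [gagliardo1, Measure.restrict_univ, Real.rpow_one, mul_one, kk]
  refine lintegral_congr fun x => lintegral_congr fun y => ?_
  rw [← ENNReal.ofReal_mul (abs_nonneg _), Real.rpow_neg (abs_nonneg _), div_eq_mul_inv]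

lemma gag_trans {s : ℝ} {u : ℝ → ℝ} (hu : Measurable u) :
    ∫⁻ x, ∫⁻ y, ENNReal.ofReal |u x - u y| * kk s (x - y) =
      2 * ∫⁻ h in Ioi 0, kk s h * ∫⁻ x, ENNReal.ofReal |u x - u (x + h)| := by
  have hk := kk_meas s
  have m1 : Measurable (fun p : ℝ × ℝ => ENNReal.ofReal |u p.1 - u (p.1 + p.2)|) := by
    fun_prop
  have m1' : Measurable (fun p : ℝ × ℝ => ENNReal.ofReal |u p.2 - u (p.2 + p.1)|) := by
    fun_prop
  calc _ = ∫⁻ x, ∫⁻ h, ENNReal.ofReal |u x - u (x + h)| * kk s h := by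
        refine lintegral_congr fun x => ?_
        rw [← lintegral_add_left_eq_self _ x]
        refine lintegral_congr fun h => ?_
        rw [← kk_neg s h]; congr 2; ring
    _ = ∫⁻ h, ∫⁻ x, ENNReal.ofReal |u x - u (x + h)| * kk s h := by
        refine lintegral_lintegral_swap (Measurable.aemeasurable ?_)
        exact m1.mul (hk.comp measurable_snd)
    _ = ∫⁻ h, kk s h * ∫⁻ x, ENNReal.ofReal |u x - u (x + h)| := by
        refine lintegral_congr fun h => ?_
        rw [lintegral_mul_const _ (by fun_prop), mul_comm]
    _ = ∫⁻ h in Ioi 0, 2 * (kk s h * ∫⁻ x, ENNReal.ofReal |u x - u (x + h)|) := by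
        rw [fold]
        · refine lintegral_congr fun h => ?_
          rw [two_mul, kk_neg]
          congr 2
          rw [← lintegral_add_right_eq_self _ h]
          refine lintegral_congr fun x => ?_
          rw [abs_sub_comm]; congr 4; ring
        · exact hk.mul (m1'.lintegral_prod_right')
    _ = _ := by
        rw [lintegral_const_mul]
        exact hk.mul (m1'.lintegral_prod_right')

lemma tri {I : Set ℝ} {f : ℝ → ℝ → ℝ≥0∞} (hf : Measurable (Function.uncurry f)) :
    ∫⁻ x in I, ∫⁻ y in I ∩ Iio x, f x y = ∫⁻ y in I, ∫⁻ x in I ∩ Ioi y, f x y := by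
  have e1 : ∀ x, ∫⁻ y in I ∩ Iio x, f x y = ∫⁻ y in I, (Iio x).indicator (f x) y := fun x => by
    rw [setLIntegral_indicator measurableSet_Iio, inter_comm]
  have e2 : ∀ y, ∫⁻ x in I ∩ Ioi y, f x y = ∫⁻ x in I, (Ioi y).indicator (fun x => f x y) x :=
    fun x => by rw [setLIntegral_indicator measurableSet_Ioi, inter_comm]
  simp_rw [e1, e2]
  have e3 : ∀ x y, (Iio x).indicator (f x) y = (Ioi y).indicator (fun x => f x y) x := by
    intro x y; simp [indicator]
  simp_rw [← e3]
  refine lintegral_lintegral_swap (Measurable.aemeasurable ?_)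
  have : (Function.uncurry fun x y => (Iio x).indicator (f x) y) =
      {p : ℝ × ℝ | p.2 < p.1}.indicator (Function.uncurry f) := by
    ext p; simp [indicator, Function.uncurry]
  rw [this]
  exact hf.indicator (measurableSet_lt measurable_snd measurable_fst)

lemma half_lower {s : ℝ} (hs : 0 < s) {v : ℝ → ℝ} (hv : Measurable v)
    (h0 : ∀ x ≤ 0, v x = 0) (hv0 : ∀ x, 0 ≤ v x) (hfin : ∫⁻ x, ENNReal.ofReal (v x) ≠ ∞) :
    ENNReal.ofReal (4 / s) * ∫⁻ x in Ioi 0, ENNReal.ofReal (v x * x ^ (-s)) ≤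
      ∫⁻ x, ∫⁻ y, ENNReal.ofReal |v x - v y| * kk s (x - y) := by
  rw [gag_trans hv]
  have hk := kk_meas s
  have key : ∀ h ∈ Ioi (0:ℝ), 2 * ∫⁻ x in Ioo 0 h, ENNReal.ofReal (v x) ≤
      ∫⁻ x, ENNReal.ofReal |v x - v (x + h)| := by
    intro h hh
    have hh := mem_Ioi.1 hh
    rw [← lintegral_add_compl (fun x => ENNReal.ofReal |v x - v (x + h)|) (measurableSet_Ioi (a := (0:ℝ))), compl_Ioi, two_mul]
    have hIoi : ∫⁻ x in Ioi h, ENNReal.ofReal (v x) ≠ ∞ :=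
      ((setLIntegral_le_lintegral _ _).trans_lt (lt_top_iff_ne_top.2 hfin)).ne
    have hshift : ∀ t : Set ℝ, MeasurableSet t →
        ∫⁻ x in (fun x => x + h) ⁻¹' t, ENNReal.ofReal (v (x + h)) = ∫⁻ x in t, ENNReal.ofReal (v x) :=
      fun t _ => (measurePreserving_add_right (volume : Measure ℝ) h).setLIntegral_comp_preimage_emb
        (measurableEmbedding_addRight h) (fun x => ENNReal.ofReal (v x)) t
    refine add_le_add ?_ ?_
    · rw [← ENNReal.add_le_add_iff_right hIoi]
      have e1 : (∫⁻ x in Ioo 0 h, ENNReal.ofReal (v x)) + ∫⁻ x in Ioi h, ENNReal.ofReal (v x)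
          = ∫⁻ x in Ioi 0, ENNReal.ofReal (v x) := by
        rw [setLIntegral_congr (Ioo_ae_eq_Ioc (a := (0:ℝ)) (b := h)),
          ← lintegral_union measurableSet_Ioi Ioc_disjoint_Ioi_same, Ioc_union_Ioi_eq_Ioi hh.le]
      rw [e1, ← hshift (Ioi h) measurableSet_Ioi]
      have hp : (fun x => x + h) ⁻¹' (Ioi h) = Ioi 0 := by ext x; simp
      rw [hp, ← lintegral_add_right _ (by fun_prop)]
      refine lintegral_mono fun x => ?_
      rw [← ENNReal.ofReal_add (abs_nonneg _) (hv0 _)]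
      exact ENNReal.ofReal_le_ofReal (by linarith [le_abs_self (v x - v (x + h))])
    · rw [← hshift _ measurableSet_Ioo]
      have hsub : (fun x => x + h) ⁻¹' (Ioo 0 h) ⊆ Iic 0 := by
        intro x hx; simp at hx ⊢; linarith [hx.2]
      refine le_trans (setLIntegral_mono_ae' (measurableSet_Ioo.preimage (by fun_prop)) (ae_of_all _ ?_)) (lintegral_mono_set (μ := volume) hsub)
      intro x hx
      rw [h0 x (hsub hx), zero_sub, abs_neg, abs_of_nonneg (hv0 _)]
  calc _ = 2 * ∫⁻ h in Ioi 0, kk s h * (2 * ∫⁻ x in Ioo 0 h, ENNReal.ofReal (v x)) := by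
        have a1 : ∀ h, kk s h * (2 * ∫⁻ x in Ioo 0 h, ENNReal.ofReal (v x)) =
            ∫⁻ x in Ioi 0 ∩ Iio h, 2 * (kk s h * ENNReal.ofReal (v x)) := by
          intro h
          rw [Ioi_inter_Iio, lintegral_const_mul _ (by fun_prop), lintegral_const_mul _ (by fun_prop)]
          ring
        simp_rw [a1]
        rw [tri (f := fun h x => 2 * (kk s h * ENNReal.ofReal (v x)))
          (by
            have h1 : Measurable fun p : ℝ × ℝ => kk s p.1 := hk.comp measurable_fst
            have h2 : Measurable fun p : ℝ × ℝ => ENNReal.ofReal (v p.2) := by fun_prop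
            exact (h1.mul h2).const_mul 2)]
        rw [← lintegral_const_mul _ (by fun_prop), ← lintegral_const_mul' _ _ (by simp)]
        refine setLIntegral_congr_fun measurableSet_Ioi fun x hx => ?_
        have hx := mem_Ioi.1 hx
        have hI : Ioi (0:ℝ) ∩ Ioi x = Ioi x := inter_eq_right.2 (Ioi_subset_Ioi hx.le)
        have ht := lint_tail (s := s) (a := x) (c := 0) hs (by linarith)
        simp only [add_zero] at ht
        simp only [hI]
        rw [lintegral_const_mul _ (by fun_prop), lintegral_mul_const _ hk, ht,
          ← ENNReal.ofReal_mul (by positivity), ← ENNReal.ofReal_mul (by positivity)]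
        have h2 : (2:ℝ≥0∞) = ENNReal.ofReal 2 := by simp
        rw [h2, ← ENNReal.ofReal_mul (by positivity), ← ENNReal.ofReal_mul (by positivity)]
        congr 1; ring
    _ ≤ _ := by
        gcongr 2 * ?_
        refine setLIntegral_mono' measurableSet_Ioi fun h hh => ?_
        gcongr
        exact key h hh

lemma mono_shift {A : ℝ → ℝ} (hA : Continuous A) (hm : Monotone A) {p q h : ℝ} (hpq : p ≤ q)
    (hh : 0 ≤ h) (h0 : ∀ x ≤ p, A x = 0) (h1 : ∀ x, q ≤ x → A x = 1) :
    ∫⁻ x, ENNReal.ofReal (A (x + h) - A x) = ENNReal.ofReal h := by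
  have e : ∫⁻ x, ENNReal.ofReal (A (x + h) - A x)
      = ∫⁻ x in Ioc (p - h) q, ENNReal.ofReal (A (x + h) - A x) := by
    rw [← lintegral_indicator measurableSet_Ioc]
    refine lintegral_congr fun x => ?_
    by_cases hx : x ∈ Ioc (p - h) q
    · rw [indicator_of_mem hx]
    · rw [indicator_of_notMem hx]
      rw [mem_Ioc, not_and_or] at hx
      rcases hx with hx | hx
      · rw [h0 (x + h) (by linarith), h0 x (by linarith)]; simp
      · rw [h1 (x + h) (by linarith), h1 x (by linarith)]; simp
  have hc1 : Continuous fun x => A (x + h) := by fun_prop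
  have hle : p - h ≤ q := by linarith
  rw [e, ← ofReal_integral_eq_lintegral_ofReal, ← intervalIntegral.integral_of_le hle,
    intervalIntegral.integral_sub (hc1.intervalIntegrable _ _) (hA.intervalIntegrable _ _),
    intervalIntegral.integral_comp_add_right (fun x => A x) h]
  · congr 1
    have i := fun a b => hA.intervalIntegrable (μ := volume) a b
    have e1 := intervalIntegral.integral_add_adjacent_intervals (i p q) (i q (q + h))
    have e2 := intervalIntegral.integral_add_adjacent_intervals (i (p - h) p) (i p q)
    have e3 : ∫ x in q..(q + h), A x = h := by
      rw [intervalIntegral.integral_congr (g := fun _ => (1:ℝ))]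
      · simp
      · intro x hx; rw [uIcc_of_le (by linarith)] at hx; exact h1 x hx.1
    have e4 : ∫ x in (p - h)..p, A x = 0 := by
      rw [intervalIntegral.integral_congr (g := fun _ => (0:ℝ))]
      · simp
      · intro x hx; rw [uIcc_of_le (by linarith)] at hx; exact h0 x hx.2
    rw [sub_add_cancel]
    linarith
  · exact ((hc1.sub hA).integrableOn_Ioc)
  · exact ae_of_all _ fun x => sub_nonneg.2 (hm (by linarith))

lemma gag_upper {s : ℝ} (hs : 0 < s) (hs1 : s < 1) {u A B : ℝ → ℝ} (hA : Continuous A) (hm : Monotone A)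
    (hB : Continuous B) (hmB : Monotone B) (huAB : ∀ x, u x = A x - B x)
    {p q p' q' a b : ℝ} (hpq : p ≤ q) (hpq' : p' ≤ q') (hab : a < b)
    (hA0 : ∀ x ≤ p, A x = 0) (hA1 : ∀ x, q ≤ x → A x = 1)
    (hB0 : ∀ x ≤ p', B x = 0) (hB1 : ∀ x, q' ≤ x → B x = 1)
    (hu1 : ∀ x, |u x| ≤ 1) (hu0 : ∀ x, x ∉ Ioo a b → u x = 0) :
    gagliardo1 s 1 univ u ≤ ENNReal.ofReal (4 * (b - a) ^ (1 - s) / (s * (1 - s))) := by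
  have hu : Measurable u := by
    have : u = fun x => A x - B x := funext huAB
    rw [this]; exact (hA.sub hB).measurable
  have hk := kk_meas s
  rw [gag_eq, gag_trans hu]
  set L := b - a with hL
  have hLp : 0 < L := by linarith
  have b1 : ∀ h, 0 ≤ h → ∫⁻ x, ENNReal.ofReal |u x - u (x + h)| ≤ ENNReal.ofReal (2 * h) := by
    intro h hh
    calc _ ≤ ∫⁻ x, (ENNReal.ofReal (A (x + h) - A x) + ENNReal.ofReal (B (x + h) - B x)) := by
          refine lintegral_mono fun x => ?_
          have p1 : 0 ≤ A (x + h) - A x := sub_nonneg.2 (hm (by linarith))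
          have p2 : 0 ≤ B (x + h) - B x := sub_nonneg.2 (hmB (by linarith))
          rw [← ENNReal.ofReal_add p1 p2]
          refine ENNReal.ofReal_le_ofReal ?_
          rw [huAB, huAB, abs_le]; constructor <;> linarith
      _ = _ := by
          rw [lintegral_add_left (by fun_prop), mono_shift hA hm hpq hh hA0 hA1,
            mono_shift hB hmB hpq' hh hB0 hB1, ← ENNReal.ofReal_add hh hh]
          congr 1; ring
  have b0 : ∫⁻ x, ENNReal.ofReal |u x| ≤ ENNReal.ofReal L := by
    calc _ ≤ ∫⁻ x, (Ioo a b).indicator (fun _ => 1) x := by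
          refine lintegral_mono fun x => ?_
          by_cases hx : x ∈ Ioo a b
          · rw [indicator_of_mem hx]; simpa using hu1 x
          · rw [indicator_of_notMem hx, hu0 x hx]; simp
      _ = _ := by rw [lintegral_indicator measurableSet_Ioo]; simp [hL]
  have b2 : ∀ h, ∫⁻ x, ENNReal.ofReal |u x - u (x + h)| ≤ ENNReal.ofReal (2 * L) := by
    intro h
    calc _ ≤ ∫⁻ x, (ENNReal.ofReal |u x| + ENNReal.ofReal |u (x + h)|) := by
          refine lintegral_mono fun x => ?_
          rw [← ENNReal.ofReal_add (abs_nonneg _) (abs_nonneg _)]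
          exact ENNReal.ofReal_le_ofReal (abs_sub _ _)
      _ ≤ ENNReal.ofReal L + ENNReal.ofReal L := by
          rw [lintegral_add_left (by fun_prop),
            lintegral_add_right_eq_self (fun x => ENNReal.ofReal |u x|) h]
          exact add_le_add b0 b0
      _ = _ := by rw [← ENNReal.ofReal_add hLp.le hLp.le]; congr 1; ring
  have c1 : ∫⁻ h in Ioc 0 L, kk s h * ENNReal.ofReal (2 * h) =
      ENNReal.ofReal (2 * L ^ (1 - s) / (1 - s)) := by
    rw [← setLIntegral_congr Ioo_ae_eq_Ioc]
    have := lint_Ioo (g := fun x => 2 * x ^ (1 - s) / (1 - s)) (g' := fun x => 2 * x ^ (-s)) hLp.le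
      (by
        refine ContinuousOn.div_const (continuousOn_const.mul ?_) _
        exact continuousOn_id.rpow_const fun x _ => Or.inr (by linarith))
      (by
        intro x hx
        have := ((hasDerivAt_id x).rpow_const (p := 1 - s) (Or.inl hx.1.ne')).const_mul 2 |>.div_const (1 - s)
        refine this.congr_deriv ?_
        have h1 : 1 - s ≠ 0 := by linarith
        have h2 : 1 - s - 1 = -s := by ring
        rw [h2]; simp only [id]; field_simp)
      (fun x hx => by have := hx.1; positivity)
    rw [Real.zero_rpow (by linarith)] at this
    simp only [mul_zero, zero_div, sub_zero] at this
    rw [← this]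
    refine setLIntegral_congr_fun measurableSet_Ioo fun x hx => ?_
    have hx := hx.1
    rw [kk_pos hx, ← ENNReal.ofReal_mul (by positivity)]
    congr 1
    have : -s = -(1 + s) + 1 := by ring
    rw [this, Real.rpow_add_one hx.ne']; ring
  have c2 : ∫⁻ h in Ioi L, kk s h * ENNReal.ofReal (2 * L) = ENNReal.ofReal (2 * L ^ (1 - s) / s) := by
    have ht := lint_tail (s := s) (a := L) (c := 0) hs (by linarith)
    simp only [add_zero] at ht
    rw [lintegral_mul_const _ hk, ht, ← ENNReal.ofReal_mul (by positivity)]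
    congr 1
    have : 1 - s = -s + 1 := by ring
    rw [this, Real.rpow_add_one hLp.ne']; ring
  calc _ ≤ 2 * ((∫⁻ h in Ioc 0 L, kk s h * ENNReal.ofReal (2 * h)) + ∫⁻ h in Ioi L, kk s h * ENNReal.ofReal (2 * L)) := by
        gcongr
        rw [← Ioc_union_Ioi_eq_Ioi hLp.le, lintegral_union measurableSet_Ioi Ioc_disjoint_Ioi_same]
        refine add_le_add ?_ ?_
        · exact setLIntegral_mono' measurableSet_Ioc fun h hh => mul_le_mul_right (b1 h hh.1.le) _
        · exact setLIntegral_mono' measurableSet_Ioi fun h hh => mul_le_mul_right (b2 h) _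
    _ = _ := by
        have h1 : 0 < 1 - s := by linarith
        have h2 : (2:ℝ≥0∞) = ENNReal.ofReal 2 := by simp
        rw [c1, c2, ← ENNReal.ofReal_add (by positivity) (by positivity), h2, ← ENNReal.ofReal_mul (by positivity)]
        congr 1; field_simp; ring

noncomputable def kap (s : ℝ) : ℝ := (2 ^ (1 - s) - 1) / (1 - s)

lemma kap_nonneg {s : ℝ} (hs1 : s < 1) : 0 ≤ kap s := by
  have : (1:ℝ) ≤ 2 ^ (1 - s) := Real.one_le_rpow (by norm_num) (by linarith)
  exact div_nonneg (by linarith) (by linarith)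

lemma kap_le {s : ℝ} (hs : 0 < s) (hs1 : s < 1) : kap s ≤ 1 := by
  have h := rpow_one_add_le_one_add_mul_self (s := 1) (p := 1 - s) (by norm_num) (by linarith) (by linarith)
  norm_num at h
  rw [kap, div_le_one (by linarith)]
  linarith

/-- the calibration: flow into `y` from `x`, `x < y` -/
noncomputable def Phi (s r y x : ℝ) : ℝ :=
  kap s * (r - x) ^ (-(1 + s)) + ((r + x) ^ (-s) - (r + y) ^ (-s)) / (s * r)

lemma mvt_pow {s a b : ℝ} (hs : 0 < s) (ha : 0 < a) (hab : a < b) :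
    a ^ (-s) - b ^ (-s) ≤ s * (b - a) * a ^ (-(1 + s)) := by
  obtain ⟨c, hc, h⟩ := exists_hasDerivAt_eq_slope (fun x => -(x ^ (-s) / s)) (fun x => x ^ (-(1 + s))) hab
    (by
      refine ContinuousOn.neg (ContinuousOn.div_const ?_ _)
      exact continuousOn_id.rpow_const fun x hx => Or.inl (by have := hx.1; simp only [id]; linarith))
    (fun x hx => by
      have := hasDeriv_tail (s := s) (x := x) (c := 0) hs (by have := hx.1; linarith)
      simpa using this)
  have hle : c ^ (-(1 + s)) ≤ a ^ (-(1 + s)) :=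
    Real.rpow_le_rpow_of_nonpos ha hc.1.le (by linarith)
  have hba : 0 < b - a := by linarith
  have : a ^ (-s) - b ^ (-s) = s * (b - a) * c ^ (-(1 + s)) := by
    rw [h]; field_simp; ring
  rw [this]
  gcongr

lemma Phi_nonneg {s r x y : ℝ} (hs : 0 < s) (hs1 : s < 1) (hx : 0 < x) (hxy : x < y) (hy : y < r) :
    0 ≤ Phi s r y x := by
  have h1 : (r + y) ^ (-s) ≤ (r + x) ^ (-s) :=
    Real.rpow_le_rpow_of_nonpos (by linarith) (by linarith) (by linarith)
  have h2 := kap_nonneg hs1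
  have h3 : 0 ≤ (r - x) ^ (-(1 + s)) := Real.rpow_nonneg (by linarith) _
  have h4 : 0 ≤ s * r := mul_nonneg hs.le (by linarith)
  exact add_nonneg (mul_nonneg h2 h3) (div_nonneg (by linarith) h4)

lemma Phi_le {s r x y : ℝ} (hs : 0 < s) (hs1 : s < 1) (hx : 0 < x) (hxy : x < y) (hy : y < r) :
    Phi s r y x ≤ (y - x) ^ (-(1 + s)) + (x + y) ^ (-(1 + s)) := by
  refine add_le_add ?_ ?_
  · have h1 : (r - x) ^ (-(1 + s)) ≤ (y - x) ^ (-(1 + s)) :=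
      Real.rpow_le_rpow_of_nonpos (by linarith) (by linarith) (by linarith)
    have h3 : 0 ≤ (r - x) ^ (-(1 + s)) := Real.rpow_nonneg (by linarith) _
    nlinarith [kap_le hs hs1]
  · have h := mvt_pow (s := s) (a := r + x) (b := r + y) hs (by linarith) (by linarith)
    have h1 : (r + x) ^ (-(1 + s)) ≤ (x + y) ^ (-(1 + s)) :=
      Real.rpow_le_rpow_of_nonpos (by linarith) (by linarith) (by linarith)
    have h3 : 0 ≤ (r + x) ^ (-(1 + s)) := Real.rpow_nonneg (by linarith) _
    have hr : 0 < r := by linarith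
    rw [div_le_iff₀ (by positivity)]
    have h5 : s * (r + y - (r + x)) * (r + x) ^ (-(1 + s)) ≤ s * r * (x + y) ^ (-(1 + s)) := by
      have : s * (r + y - (r + x)) ≤ s * r := by nlinarith
      have h6 : 0 ≤ s * r := by positivity
      exact mul_le_mul this h1 h3 h6
    linarith

noncomputable def pp (s r y : ℝ) : ℝ :=
  kap s * ((r - y) ^ (-s) - r ^ (-s)) / s +
    (((r + y) ^ (1 - s) - r ^ (1 - s)) / (1 - s) - y * (r + y) ^ (-s)) / (s * r)

noncomputable def qq (s r x : ℝ) : ℝ :=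
  kap s * (r - x) ^ (-s) +
    ((r - x) * (r + x) ^ (-s) - ((2 * r) ^ (1 - s) - (r + x) ^ (1 - s)) / (1 - s)) / (s * r)

noncomputable def EE (s r x : ℝ) : ℝ := ((r - x) ^ (-s) + (r + x) ^ (-s)) / s

lemma pq_id {s r x : ℝ} (hs : 0 < s) (hs1 : s < 1) (hx : 0 < x) (hxr : x < r) :
    pp s r x + EE s r x = 2 ^ (1 - s) / s * (r - x) ^ (-s) + qq s r x := by
  have hr : 0 < r := by linarith
  have e1 : (2 * r) ^ (1 - s) = 2 ^ (1 - s) * (r * r ^ (-s)) := by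
    rw [Real.mul_rpow (by norm_num) hr.le, sub_eq_neg_add, Real.rpow_add_one hr.ne']; ring
  have e2 : r ^ (1 - s) = r * r ^ (-s) := by
    rw [sub_eq_neg_add, Real.rpow_add_one hr.ne']; ring
  have h1 : 1 - s ≠ 0 := by linarith
  unfold pp qq EE kap
  rw [e1, e2]
  field_simp
  ring

lemma hasDeriv_pow {s x c : ℝ} (hs1 : s < 1) (hx : 0 < c + x) :
    HasDerivAt (fun y => (c + y) ^ (1 - s) / (1 - s)) ((c + x) ^ (-s)) x := by
  have h1 := (((hasDerivAt_id x).const_add c).rpow_const (p := 1 - s) (Or.inl hx.ne')).div_const (1 - s)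
  refine h1.congr_deriv ?_
  have : 1 - s - 1 = -s := by ring
  have h2 : 1 - s ≠ 0 := by linarith
  rw [this]
  simp only [id]
  field_simp

lemma hasDeriv_refl {s x r : ℝ} (hs : 0 < s) (hx : x < r) :
    HasDerivAt (fun y => (r - y) ^ (-s) / s) ((r - x) ^ (-(1 + s))) x := by
  have h1 := (((hasDerivAt_id x).const_sub r).rpow_const (p := -s) (Or.inl (sub_pos.2 hx).ne')).div_const s
  refine h1.congr_deriv ?_
  have : -s - 1 = -(1 + s) := by ring
  rw [this]
  simp only [id]
  field_simp

lemma int_p {s r y : ℝ} (hs : 0 < s) (hs1 : s < 1) (hy : 0 < y) (hyr : y < r) :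
    ∫⁻ x in Ioo 0 y, ENNReal.ofReal (Phi s r y x) = ENNReal.ofReal (pp s r y) := by
  have hd : ∀ x ∈ Icc 0 y, HasDerivAt (fun x => kap s * ((r - x) ^ (-s) / s) +
      ((r + x) ^ (1 - s) / (1 - s) - x * (r + y) ^ (-s)) / (s * r)) (Phi s r y x) x := by
    intro x hx
    have h1 := (hasDeriv_refl (s := s) (x := x) (r := r) hs (by linarith [hx.2])).const_mul (kap s)
    have h2 := (((hasDeriv_pow (s := s) (x := x) (c := r) hs1 (by linarith [hx.1])).sub
      ((hasDerivAt_id x).mul_const ((r + y) ^ (-s)))).div_const (s * r))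
    refine (h1.add h2).congr_deriv ?_
    simp [Phi]
  rw [lint_Ioo hy.le (fun x hx => (hd x hx).continuousAt.continuousWithinAt)
    (fun x hx => hd x (Ioo_subset_Icc_self hx)) (fun x hx => Phi_nonneg hs hs1 hx.1 hx.2 hyr)]
  congr 1
  simp only [pp, sub_zero, add_zero, zero_mul]
  ring

lemma int_q {s r x : ℝ} (hs : 0 < s) (hs1 : s < 1) (hx : 0 < x) (hxr : x < r) :
    ∫⁻ y in Ioo x r, ENNReal.ofReal (Phi s r y x) = ENNReal.ofReal (qq s r x) := by
  have hd : ∀ y ∈ Icc x r, HasDerivAt (fun y => kap s * (r - x) ^ (-(1 + s)) * y +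
      (y * (r + x) ^ (-s) - (r + y) ^ (1 - s) / (1 - s)) / (s * r)) (Phi s r y x) y := by
    intro y hy
    have h1 := (hasDerivAt_id y).const_mul (kap s * (r - x) ^ (-(1 + s)))
    have h2 := ((((hasDerivAt_id y).mul_const ((r + x) ^ (-s))).sub
      (hasDeriv_pow (s := s) (x := y) (c := r) hs1 (by linarith [hy.1])))).div_const (s * r)
    refine (h1.add h2).congr_deriv ?_
    simp [Phi]
  rw [lint_Ioo hxr.le (fun x hx => (hd x hx).continuousAt.continuousWithinAt)
    (fun x hx => hd x (Ioo_subset_Icc_self hx)) (fun y hy => Phi_nonneg hs hs1 hx hy.1 hy.2)]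
  congr 1
  have e : (r - x) ^ (-s) = (r - x) ^ (-(1 + s)) * (r - x) := by
    rw [← Real.rpow_add_one (by linarith)]; congr 1; ring
  simp only [qq, e]
  rw [two_mul]
  ring

lemma pp_nonneg {s r y : ℝ} (hs : 0 < s) (hs1 : s < 1) (hy : 0 < y) (hyr : y < r) :
    0 ≤ pp s r y := by
  have hr : 0 < r := by linarith
  have h1 : r ^ (-s) ≤ (r - y) ^ (-s) := Real.rpow_le_rpow_of_nonpos (by linarith) (by linarith) (by linarith)
  have hk := kap_nonneg hs1
  refine add_nonneg (div_nonneg (mul_nonneg hk (by linarith)) hs.le) (div_nonneg ?_ (by positivity))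
  obtain ⟨c, hc, h⟩ := exists_hasDerivAt_eq_slope (fun y => (r + y) ^ (1 - s) / (1 - s)) (fun x => (r + x) ^ (-s)) hy
    (fun x hx => (hasDeriv_pow (s := s) (x := x) (c := r) hs1 (by linarith [hx.1])).continuousAt.continuousWithinAt)
    (fun x hx => hasDeriv_pow (s := s) (x := x) (c := r) hs1 (by linarith [hx.1]))
  have hle : (r + y) ^ (-s) ≤ (r + c) ^ (-s) :=
    Real.rpow_le_rpow_of_nonpos (by linarith [hc.1]) (by linarith [hc.2]) (by linarith)
  rw [h, sub_zero, add_zero, le_div_iff₀ hy] at hle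
  rw [sub_div]
  linarith

lemma qq_nonneg {s r x : ℝ} (hs : 0 < s) (hs1 : s < 1) (hx : 0 < x) (hxr : x < r) :
    0 ≤ qq s r x := by
  have hr : 0 < r := by linarith
  have hk := kap_nonneg hs1
  refine add_nonneg (mul_nonneg hk (Real.rpow_nonneg (by linarith) _)) (div_nonneg ?_ (by positivity))
  obtain ⟨c, hc, h⟩ := exists_hasDerivAt_eq_slope (fun y => (r + y) ^ (1 - s) / (1 - s)) (fun x => (r + x) ^ (-s)) hxr
    (fun y hy => (hasDeriv_pow (s := s) (x := y) (c := r) hs1 (by linarith [hy.1])).continuousAt.continuousWithinAt)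
    (fun y hy => hasDeriv_pow (s := s) (x := y) (c := r) hs1 (by linarith [hy.1]))
  have hle : (r + c) ^ (-s) ≤ (r + x) ^ (-s) :=
    Real.rpow_le_rpow_of_nonpos (by linarith) (by linarith [hc.1]) (by linarith)
  rw [h, div_le_iff₀ (by linarith)] at hle
  rw [sub_div, two_mul]
  linarith

lemma qq_le {s r x : ℝ} (hs : 0 < s) (hs1 : s < 1) (hx : 0 < x) (hxr : x < r) :
    qq s r x ≤ (1 + 1 / s) * (r - x) ^ (-s) := by
  have hr : 0 < r := by linarith
  have h1 : (r + x) ^ (-s) ≤ (r - x) ^ (-s) := Real.rpow_le_rpow_of_nonpos (by linarith) (by linarith) (by linarith)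
  have h2 : (r + x) ^ (1 - s) ≤ (2 * r) ^ (1 - s) := Real.rpow_le_rpow (by linarith) (by linarith) (by linarith)
  have h3 : 0 ≤ ((2 * r) ^ (1 - s) - (r + x) ^ (1 - s)) / (1 - s) := div_nonneg (by linarith) (by linarith)
  have h4 : 0 < (r - x) ^ (-s) := Real.rpow_pos_of_pos (by linarith) _
  have h5 : 0 < (r + x) ^ (-s) := Real.rpow_pos_of_pos (by linarith) _
  rw [add_mul]
  refine add_le_add ?_ ?_
  · exact mul_le_mul_of_nonneg_right (kap_le hs hs1) h4.le
  · rw [div_le_iff₀ (by positivity)]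
    have : 1 / s * (r - x) ^ (-s) * (s * r) = r * (r - x) ^ (-s) := by field_simp
    rw [this]
    have : (r - x) * (r + x) ^ (-s) ≤ r * (r - x) ^ (-s) := by
      apply mul_le_mul <;> linarith
    linarith

lemma fold_lower {s : ℝ} {v : ℝ → ℝ} (hv : Measurable v) :
    2 * ∫⁻ x in Ioi 0, ∫⁻ y in Ioi x,
      ENNReal.ofReal |v x + v (-x) - (v y + v (-y))| * (kk s (y - x) + kk s (x + y)) ≤
    ∫⁻ x, ∫⁻ y, ENNReal.ofReal |v x - v y| * kk s (x - y) := by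
  have hk := kk_meas s
  have mK : Measurable fun p : ℝ × ℝ => ENNReal.ofReal |v p.1 - v p.2| * kk s (p.1 - p.2) := by
    have : Measurable fun p : ℝ × ℝ => kk s (p.1 - p.2) := hk.comp (by fun_prop)
    fun_prop
  set M : ℝ → ℝ → ℝ≥0∞ := fun x y =>
    ENNReal.ofReal |v x + v (-x) - (v y + v (-y))| * (kk s (y - x) + kk s (x + y)) with hM
  have mM : Measurable (Function.uncurry M) := by
    have h1 : Measurable fun p : ℝ × ℝ => kk s (p.2 - p.1) := hk.comp (by fun_prop)
    have h2 : Measurable fun p : ℝ × ℝ => kk s (p.1 + p.2) := hk.comp (by fun_prop)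
    have h3 : Measurable fun p : ℝ × ℝ => ENNReal.ofReal |v p.1 + v (-p.1) - (v p.2 + v (-p.2))| := by fun_prop
    exact h3.mul (h1.add h2)
  have symM : ∀ x y, M x y = M y x := by
    intro x y
    simp only [hM]
    rw [abs_sub_comm, ← kk_neg s (y - x), neg_sub, add_comm x y]
  have mKx : ∀ x, Measurable fun y => ENNReal.ofReal |v x - v y| * kk s (x - y) := fun x =>
    mK.comp measurable_prodMk_left
  have step1 : ∫⁻ x in Ioi 0, ∫⁻ y in Ioi 0, M x y ≤
      ∫⁻ x, ∫⁻ y, ENNReal.ofReal |v x - v y| * kk s (x - y) := by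
    rw [fold _ mK.lintegral_prod_right']
    refine lintegral_mono fun x => ?_
    simp only []
    rw [fold _ (mKx x), fold _ (mKx (-x)), ← lintegral_add_left (by
      have a1 := mKx x
      have a2 := (mKx x).comp measurable_neg
      exact a1.add a2)]
    refine lintegral_mono fun y => ?_
    simp only [hM]
    have e1 : kk s (x - y) = kk s (y - x) := by rw [← kk_neg]; congr 1; ring
    have e2 : kk s (x - -y) = kk s (x + y) := by congr 1; ring
    have e3 : kk s (-x - y) = kk s (x + y) := by rw [← kk_neg]; congr 1; ring
    have e4 : kk s (-x - -y) = kk s (y - x) := by congr 1; ring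
    rw [e1, e2, e3, e4, mul_add]
    have t1 : ENNReal.ofReal |v x + v (-x) - (v y + v (-y))| ≤
        ENNReal.ofReal |v x - v y| + ENNReal.ofReal |v (-x) - v (-y)| := by
      rw [← ENNReal.ofReal_add (abs_nonneg _) (abs_nonneg _)]
      refine ENNReal.ofReal_le_ofReal (le_trans (le_of_eq ?_) (abs_add_le _ _))
      congr 1; ring
    have t2 : ENNReal.ofReal |v x + v (-x) - (v y + v (-y))| ≤
        ENNReal.ofReal |v x - v (-y)| + ENNReal.ofReal |v (-x) - v y| := by
      rw [← ENNReal.ofReal_add (abs_nonneg _) (abs_nonneg _)]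
      refine ENNReal.ofReal_le_ofReal (le_trans (le_of_eq ?_) (abs_add_le _ _))
      congr 1; ring
    calc _ ≤ (ENNReal.ofReal |v x - v y| + ENNReal.ofReal |v (-x) - v (-y)|) * kk s (y - x) +
          (ENNReal.ofReal |v x - v (-y)| + ENNReal.ofReal |v (-x) - v y|) * kk s (x + y) := by
          gcongr
      _ = _ := by ring
  refine le_trans ?_ step1
  have hI : ∀ x ∈ Ioi (0:ℝ), Ioi (0:ℝ) ∩ Ioi x = Ioi x := fun x hx =>
    inter_eq_right.2 (Ioi_subset_Ioi (mem_Ioi.1 hx).le)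
  have e0 : ∫⁻ x in Ioi 0, ∫⁻ y in Ioi x, M x y = ∫⁻ x in Ioi 0, ∫⁻ y in Ioi 0 ∩ Ioi x, M x y :=
    setLIntegral_congr_fun measurableSet_Ioi fun x hx => by simp only [hI x hx]
  have e1 : ∫⁻ x in Ioi 0, ∫⁻ y in Ioi 0 ∩ Ioi x, M x y = ∫⁻ x in Ioi 0, ∫⁻ y in Ioi 0 ∩ Iio x, M x y := by
    rw [tri mM]
    refine lintegral_congr fun x => lintegral_congr fun y => symM _ _
  have mI : Measurable fun x => ∫⁻ y in Ioi 0 ∩ Iio x, M x y := by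
    have : ∀ x, ∫⁻ y in Ioi 0 ∩ Iio x, M x y = ∫⁻ y in Ioi 0, (Iio x).indicator (M x) y := fun x => by
      rw [setLIntegral_indicator measurableSet_Iio, inter_comm]
    simp_rw [this]
    have h : (fun p : ℝ × ℝ => (Iio p.1).indicator (M p.1) p.2) =
        {p : ℝ × ℝ | p.2 < p.1}.indicator (Function.uncurry M) := by
      ext p; simp [indicator, Function.uncurry]
    have h' : Measurable (fun p : ℝ × ℝ => (Iio p.1).indicator (M p.1) p.2) := by
      rw [h]; exact mM.indicator (measurableSet_lt measurable_snd measurable_fst)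
    exact h'.lintegral_prod_right'
  rw [two_mul]
  nth_rewrite 1 [e0, e1]
  rw [e0, ← lintegral_add_left mI]
  refine lintegral_mono fun x => ?_
  simp only []
  rw [← lintegral_union (measurableSet_Ioi.inter measurableSet_Ioi)]
  · exact lintegral_mono_set (union_subset inter_subset_left inter_subset_left)
  · rw [Set.disjoint_left]
    intro y hy hy'
    exact lt_asymm (mem_Iio.1 hy.2) (mem_Ioi.1 hy'.2)

set_option maxHeartbeats 1000000 in
lemma interval_lower {s r : ℝ} (hs : 0 < s) (hs1 : s < 1) (hr : 0 < r) {v : ℝ → ℝ} (hv : Measurable v)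
    (h0 : ∀ x, r ≤ |x| → v x = 0) (hv0 : ∀ x, 0 ≤ v x) {B : ℝ} (hB : ∀ x, v x ≤ B) :
    ENNReal.ofReal (2 ^ (2 - s) / s) * ∫⁻ x in Ioo (-r) r, ENNReal.ofReal (v x * (r - |x|) ^ (-s)) ≤
      ∫⁻ x, ∫⁻ y, ENNReal.ofReal |v x - v y| * kk s (x - y) := by
  refine le_trans ?_ (fold_lower hv)
  have hk := kk_meas s
  set m : ℝ → ℝ := fun x => v x + v (-x) with hm
  have mm : Measurable m := by fun_prop
  have hm0 : ∀ x, 0 ≤ m x := fun x => add_nonneg (hv0 _) (hv0 _)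
  have hmr : ∀ x, r ≤ x → m x = 0 := fun x hx => by
    have : r ≤ |x| := hx.trans (le_abs_self x)
    simp only [hm]; rw [h0 x this, h0 (-x) (by rwa [abs_neg])]; simp
  have hmB : ∀ x, m x ≤ 2 * B := fun x => by simp only [hm]; linarith [hB x, hB (-x)]
  -- left side folded
  have L1 : ∫⁻ x in Ioo (-r) r, ENNReal.ofReal (v x * (r - |x|) ^ (-s)) =
      ∫⁻ x in Ioo 0 r, ENNReal.ofReal (m x * (r - x) ^ (-s)) := by
    rw [← lintegral_indicator measurableSet_Ioo, fold _ (by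
      refine Measurable.indicator ?_ measurableSet_Ioo; fun_prop)]
    have : Ioo 0 r = Ioi 0 ∩ Iio r := rfl
    rw [this, inter_comm, ← setLIntegral_indicator measurableSet_Iio]
    refine setLIntegral_congr_fun measurableSet_Ioi fun x hx => ?_
    have hx := mem_Ioi.1 hx
    by_cases hxr : x < r
    · simp only [indicator, mem_Ioo, mem_Iio]
      rw [if_pos ⟨by linarith, hxr⟩, if_pos ⟨by linarith, by linarith⟩, if_pos hxr, abs_neg, abs_of_pos hx]
      have h1 : 0 ≤ (r - x) ^ (-s) := Real.rpow_nonneg (by linarith) _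
      rw [← ENNReal.ofReal_add (mul_nonneg (hv0 _) h1) (mul_nonneg (hv0 _) h1)]
      congr 1; simp only [hm]; ring
    · simp only [indicator, mem_Ioo, mem_Iio]
      rw [if_neg (fun h => hxr h.2), if_neg (fun h => hxr (by linarith [h.1])), if_neg hxr]; simp
  rw [L1]
  set M : ℝ → ℝ → ℝ≥0∞ := fun x y => ENNReal.ofReal |m x - m y| * (kk s (y - x) + kk s (x + y)) with hM
  have mM : Measurable (Function.uncurry M) := by
    have h1 : Measurable fun p : ℝ × ℝ => kk s (p.2 - p.1) := hk.comp (by fun_prop)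
    have h2 : Measurable fun p : ℝ × ℝ => kk s (p.1 + p.2) := hk.comp (by fun_prop)
    have h3 : Measurable fun p : ℝ × ℝ => ENNReal.ofReal |m p.1 - m p.2| := by fun_prop
    exact h3.mul (h1.add h2)
  have mPhi : Measurable fun p : ℝ × ℝ => ENNReal.ofReal (Phi s r p.1 p.2) := by
    unfold Phi; fun_prop
  have mPhi' : ∀ x, Measurable fun y => ENNReal.ofReal (Phi s r y x) := fun x => by
    unfold Phi; fun_prop
  have mpp : Measurable (pp s r) := by unfold pp; fun_prop
  have mqq : Measurable (qq s r) := by unfold qq; fun_prop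
  have mEE : Measurable (EE s r) := by unfold EE; fun_prop
  -- exterior
  have ext : ∀ x ∈ Ioo 0 r, ∫⁻ y in Ioi r, M x y = ENNReal.ofReal (m x * EE s r x) := by
    intro x hx
    have h1 : ∫⁻ y in Ioi r, M x y = ∫⁻ y in Ioi r, ENNReal.ofReal (m x) * (kk s (y + -x) + kk s (y + x)) := by
      refine setLIntegral_congr_fun measurableSet_Ioi fun y hy => ?_
      simp only [hM]
      rw [hmr y (mem_Ioi.1 hy).le, sub_zero, abs_of_nonneg (hm0 x), add_comm x y, sub_eq_add_neg]
    have k1 : Measurable fun y => kk s (y + -x) := hk.comp (by fun_prop)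
    have k2 : Measurable fun y => kk s (y + x) := hk.comp (by fun_prop)
    have hp1 : 0 < r + -x := by linarith [hx.2]
    have hp2 : 0 < r + x := by linarith [hx.1]
    rw [h1, lintegral_const_mul _ (by exact k1.add k2), lintegral_add_left k1,
      lint_tail hs hp1, lint_tail hs hp2, ← ENNReal.ofReal_add (by positivity) (by positivity),
      ← ENNReal.ofReal_mul (hm0 x), EE, add_div, ← sub_eq_add_neg]
  -- interior
  set A := ∫⁻ x in Ioo 0 r, ∫⁻ y in Ioo x r, M x y with hA
  set Q := ∫⁻ x in Ioo 0 r, ENNReal.ofReal (m x * qq s r x) with hQ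
  set P := ∫⁻ x in Ioo 0 r, ENNReal.ofReal (m x * pp s r x) with hP
  set E := ∫⁻ x in Ioo 0 r, ENNReal.ofReal (m x * EE s r x) with hE
  set D := ∫⁻ x in Ioo 0 r, ENNReal.ofReal (m x * (r - x) ^ (-s)) with hD
  have hIr : ∀ x ∈ Ioo 0 r, Ioo 0 r ∩ Ioi x = Ioo x r := fun x hx => by
    ext y; simp only [mem_inter_iff, mem_Ioo, mem_Ioi]
    exact ⟨fun h => ⟨h.2, h.1.2⟩, fun h => ⟨⟨hx.1.trans h.1, h.2⟩, h.1⟩⟩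
  have hIl : ∀ x ∈ Ioo 0 r, Ioo 0 r ∩ Iio x = Ioo 0 x := fun x hx => by
    ext y; simp only [mem_inter_iff, mem_Ioo, mem_Iio]
    exact ⟨fun h => ⟨h.1.1, h.2⟩, fun h => ⟨⟨h.1, h.2.trans hx.2⟩, h.2⟩⟩
  have lowE : A + E ≤ ∫⁻ x in Ioi 0, ∫⁻ y in Ioi x, M x y := by
    rw [hE, hA, ← lintegral_add_right _ (by fun_prop)]
    refine le_trans ?_ (lintegral_mono_set (Ioo_subset_Ioi_self : Ioo 0 r ⊆ Ioi 0))
    refine setLIntegral_mono' measurableSet_Ioo fun x hx => ?_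
    rw [← ext x hx, ← lintegral_union measurableSet_Ioi]
    · refine lintegral_mono_set (union_subset Ioo_subset_Ioi_self (Ioi_subset_Ioi hx.2.le))
    · rw [Set.disjoint_left]
      intro y hy hy'
      exact lt_asymm hy.2 (mem_Ioi.1 hy')
  have APQ : P ≤ A + Q := by
    have hQ' : Q = ∫⁻ x in Ioo 0 r, ∫⁻ y in Ioo x r, ENNReal.ofReal (m x) * ENNReal.ofReal (Phi s r y x) := by
      refine setLIntegral_congr_fun measurableSet_Ioo fun x hx => ?_
      rw [lintegral_const_mul _ (mPhi' x), int_q hs hs1 hx.1 hx.2, ENNReal.ofReal_mul (hm0 x)]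
    have hP' : P = ∫⁻ x in Ioo 0 r, ∫⁻ y in Ioo x r, ENNReal.ofReal (m y) * ENNReal.ofReal (Phi s r y x) := by
      have t := tri (I := Ioo 0 r) (f := fun y x => ENNReal.ofReal (m y) * ENNReal.ofReal (Phi s r y x)) (by
        have h1 : Measurable fun p : ℝ × ℝ => ENNReal.ofReal (m p.1) := by fun_prop
        exact h1.mul mPhi)
      have t2 : ∫⁻ x in Ioo 0 r, ∫⁻ y in Ioo x r, ENNReal.ofReal (m y) * ENNReal.ofReal (Phi s r y x) =
          ∫⁻ x in Ioo 0 r, ∫⁻ y in Ioo 0 r ∩ Ioi x, ENNReal.ofReal (m y) * ENNReal.ofReal (Phi s r y x) :=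
        setLIntegral_congr_fun measurableSet_Ioo fun x hx => by simp only [hIr x hx]
      rw [t2, ← t]
      refine setLIntegral_congr_fun measurableSet_Ioo fun y hy => ?_
      simp only [hIl y hy]
      rw [lintegral_const_mul _ (by unfold Phi; fun_prop), int_p hs hs1 hy.1 hy.2, ENNReal.ofReal_mul (hm0 y)]
    have mQ : Measurable fun x => ENNReal.ofReal (m x * qq s r x) := by fun_prop
    have hAQ : A + Q = ∫⁻ x in Ioo 0 r, ((∫⁻ y in Ioo x r, M x y) + ENNReal.ofReal (m x * qq s r x)) := by
      rw [lintegral_add_right _ mQ]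
    rw [hAQ, hP']
    refine setLIntegral_mono' measurableSet_Ioo fun x hx => ?_
    rw [ENNReal.ofReal_mul (hm0 x), ← int_q hs hs1 hx.1 hx.2, ← lintegral_const_mul _ (mPhi' x),
      ← lintegral_add_right _ ((mPhi' x).const_mul _)]
    refine setLIntegral_mono' measurableSet_Ioo fun y hy => ?_
    have hpos := Phi_nonneg hs hs1 hx.1 hy.1 hy.2
    have hle := Phi_le hs hs1 hx.1 hy.1 hy.2
    have a1 : 0 < y - x := by linarith [hy.1]
    have a2 : 0 < x + y := by linarith [hx.1]
    simp only [hM]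
    rw [kk_pos a1, kk_pos a2, ← ENNReal.ofReal_add (by positivity) (by positivity),
      ← ENNReal.ofReal_mul (hm0 _), ← ENNReal.ofReal_mul (hm0 _), ← ENNReal.ofReal_mul (abs_nonneg _),
      ← ENNReal.ofReal_add (by positivity) (mul_nonneg (hm0 _) hpos)]
    refine ENNReal.ofReal_le_ofReal ?_
    have b1 : m y - m x ≤ |m x - m y| := by rw [abs_sub_comm]; exact le_abs_self _
    have b2 : (m y - m x) * Phi s r y x ≤ |m x - m y| * ((y - x) ^ (-(1 + s)) + (x + y) ^ (-(1 + s))) :=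
      (mul_le_mul_of_nonneg_right b1 hpos).trans (mul_le_mul_of_nonneg_left hle (abs_nonneg _))
    linarith
  have hQfin : Q ≠ ∞ := by
    have b : Q ≤ ∫⁻ x in Ioo 0 r, ENNReal.ofReal (2 * B * (1 + 1 / s)) * ENNReal.ofReal ((r - x) ^ (-s)) := by
      refine setLIntegral_mono' measurableSet_Ioo fun x hx => ?_
      have hB0 : 0 ≤ B := (hv0 0).trans (hB 0)
      rw [← ENNReal.ofReal_mul (by positivity)]
      refine ENNReal.ofReal_le_ofReal ?_
      rw [mul_assoc]
      exact mul_le_mul (hmB x) (qq_le hs hs1 hx.1 hx.2) (qq_nonneg hs hs1 hx.1 hx.2) (by positivity)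
    refine (b.trans_lt ?_).ne
    rw [lintegral_const_mul _ (by fun_prop)]
    have h1 : 0 < 1 - s := by linarith
    rw [lint_Ioo (g := fun x => -((r - x) ^ (1 - s) / (1 - s))) hr.le]
    · exact ENNReal.mul_lt_top ENNReal.ofReal_lt_top ENNReal.ofReal_lt_top
    · refine ContinuousOn.neg (ContinuousOn.div_const ?_ _)
      exact (continuousOn_const.sub continuousOn_id).rpow_const fun x _ => Or.inr h1.le
    · intro x hx
      have := (((hasDerivAt_id x).const_sub r).rpow_const (p := 1 - s) (Or.inl (sub_pos.2 hx.2).ne')).div_const (1 - s) |>.neg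
      refine this.congr_deriv ?_
      have h2 : 1 - s - 1 = -s := by ring
      rw [h2]; simp only [id]; field_simp
    · intro x hx; exact Real.rpow_nonneg (by linarith [hx.2]) _
  have idn : P + E = ENNReal.ofReal (2 ^ (1 - s) / s) * D + Q := by
    rw [hP, hE, hD, hQ, ← lintegral_const_mul _ (by fun_prop), ← lintegral_add_left (by fun_prop),
      ← lintegral_add_left (by fun_prop)]
    refine setLIntegral_congr_fun measurableSet_Ioo fun x hx => ?_
    have c1 := pp_nonneg hs hs1 hx.1 hx.2
    have c2 := qq_nonneg hs hs1 hx.1 hx.2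
    have c4 : 0 < r - x := by linarith [hx.2]
    have c5 : 0 < r + x := by linarith [hx.1]
    have c3 : 0 ≤ EE s r x := by unfold EE; positivity
    have hmx := hm0 x
    rw [← ENNReal.ofReal_mul (by positivity), ← ENNReal.ofReal_add (by positivity) (by positivity),
      ← ENNReal.ofReal_add (by positivity) (by positivity)]
    congr 1
    rw [← mul_add, pq_id hs hs1 hx.1 hx.2]; ring
  have main : ENNReal.ofReal (2 ^ (1 - s) / s) * D ≤ A + E := by
    rw [← ENNReal.add_le_add_iff_right hQfin, ← idn]
    calc P + E ≤ A + Q + E := by gcongr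
      _ = A + E + Q := by ring
  have hc : ENNReal.ofReal (2 ^ (2 - s) / s) = 2 * ENNReal.ofReal (2 ^ (1 - s) / s) := by
    have h2 : (2:ℝ≥0∞) = ENNReal.ofReal 2 := by simp
    rw [h2, ← ENNReal.ofReal_mul (by positivity)]
    congr 1
    have : (2:ℝ) - s = (1 - s) + 1 := by ring
    rw [this, Real.rpow_add_one (by norm_num)]; ring
  rw [hc, mul_assoc]
  gcongr
  exact main.trans lowE

lemma gag_abs {s : ℝ} (u : ℝ → ℝ) :
    ∫⁻ x, ∫⁻ y, ENNReal.ofReal |(|u x|) - (|u y|)| * kk s (x - y) ≤ gagliardo1 s 1 univ u := by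
  rw [gag_eq]
  refine lintegral_mono fun x => lintegral_mono fun y => ?_
  exact mul_le_mul' (ENNReal.ofReal_le_ofReal (abs_abs_sub_abs_le _ _)) le_rfl

lemma hardy_ge {s C : ℝ} {Ω : Set ℝ}
    (h : ∀ u : ℝ → ℝ, Continuous u → HasCompactSupport u → tsupport u ⊆ Ω →
      ENNReal.ofReal C * ∫⁻ x in Ω, ENNReal.ofReal (|u x| / infDist x (frontier Ω) ^ s) ≤
        gagliardo1 s 1 univ u) :
    ENNReal.ofReal C ≤ hardyConst1 s 1 Ω := by
  refine le_sInf ?_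
  rintro c ⟨u, hu, hc, ht, hint, rfl⟩
  simp only [Real.rpow_one, mul_one] at hint
  have hi : Integrable (fun x => |u x| / infDist x (frontier Ω) ^ s) (volume.restrict Ω) := by
    by_contra hcon
    rw [integral_undef hcon] at hint
    norm_num at hint
  have := h u hu.continuous hc ht
  rw [← ofReal_integral_eq_lintegral_ofReal hi (ae_of_all _ fun x =>
    div_nonneg (abs_nonneg _) (Real.rpow_nonneg infDist_nonneg _)), hint] at this
  simpa using this

lemma u_bdd {u : ℝ → ℝ} (hu : Continuous u) (hc : HasCompactSupport u) : ∃ B, ∀ x, |u x| ≤ B := by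
  obtain ⟨B, hB⟩ := hu.bounded_above_of_compact_support hc
  exact ⟨B, fun x => by simpa using hB x⟩

lemma zero_of {u : ℝ → ℝ} {Ω : Set ℝ} (ht : tsupport u ⊆ Ω) {x : ℝ} (hx : x ∉ Ω) : u x = 0 :=
  image_eq_zero_of_notMem_tsupport fun h => hx (ht h)

lemma infD {a b x : ℝ} (hab : a < b) (hx : x ∈ Ioo a b) :
    infDist x (frontier (Ioo a b)) = min (x - a) (b - x) := by
  rw [frontier_Ioo hab]
  have e1 : dist x a = x - a := by rw [Real.dist_eq, abs_of_pos (by linarith [hx.1])]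
  have e2 : dist x b = b - x := by rw [dist_comm, Real.dist_eq, abs_of_pos (by linarith [hx.2])]
  refine le_antisymm (le_min ?_ ?_) ?_
  · rw [← e1]; exact infDist_le_dist_of_mem (by simp)
  · rw [← e2]; exact infDist_le_dist_of_mem (by simp)
  · rw [le_infDist (by simp)]
    intro y hy
    rcases hy with rfl | hy
    · rw [e1]; exact min_le_left _ _
    · rw [mem_singleton_iff.1 hy, e2]; exact min_le_right _ _

lemma infD' {x : ℝ} (hx : 0 < x) : infDist x (frontier (Ioi (0:ℝ))) = x := by
  rw [frontier_Ioi, infDist_singleton, Real.dist_eq, sub_zero, abs_of_pos hx]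

lemma half_ge {s : ℝ} (hs : 0 < s) : ENNReal.ofReal (4 / s) ≤ hardyConst1 s 1 (Ioi 0) := by
  refine hardy_ge fun u hu hc ht => le_trans ?_ (gag_abs u)
  have := half_lower hs (v := fun x => |u x|) (by fun_prop)
    (fun x hx => by rw [zero_of ht (notMem_Ioi.2 hx)]; simp) (fun x => abs_nonneg _)
    (by
      have h := (hu.integrable_of_hasCompactSupport (μ := volume) hc).abs
      have h2 := ofReal_integral_eq_lintegral_ofReal h (ae_of_all _ fun x => abs_nonneg _)
      rw [← h2]; exact ENNReal.ofReal_ne_top)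
  refine le_trans (le_of_eq ?_) this
  congr 1
  refine setLIntegral_congr_fun measurableSet_Ioi fun x hx => ?_
  rw [infD' hx, Real.rpow_neg (mem_Ioi.1 hx).le, div_eq_mul_inv]

lemma int_ge {s a b : ℝ} (hs : 0 < s) (hs1 : s < 1) (hab : a < b) :
    ENNReal.ofReal (2 ^ (2 - s) / s) ≤ hardyConst1 s 1 (Ioo a b) := by
  refine hardy_ge fun u hu hc ht => le_trans ?_ (gag_abs u)
  obtain ⟨B, hB⟩ := u_bdd hu hc
  set c := (a + b) / 2 with hcdef
  set r := (b - a) / 2 with hrdef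
  have := interval_lower hs hs1 (r := r) (by rw [hrdef]; linarith) (v := fun x => |u (x + c)|) (by fun_prop)
    (fun x hx => by
      rw [zero_of ht, abs_zero]
      intro hm
      have : |x| < r := by rw [abs_lt]; constructor <;> linarith [hm.1, hm.2]
      linarith) (fun x => abs_nonneg _) (fun x => hB _)
  refine le_trans (le_of_eq ?_) (le_trans this (le_of_eq ?_))
  · congr 1
    have e := (measurePreserving_add_right (volume : Measure ℝ) c).setLIntegral_comp_preimage_emb
        (measurableEmbedding_addRight c)
        (fun x => ENNReal.ofReal (|u x| / infDist x (frontier (Ioo a b)) ^ s)) (Ioo a b)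
    have hp : (fun x => x + c) ⁻¹' Ioo a b = Ioo (-r) r := by
      rw [preimage_add_const_Ioo]; congr 1 <;> (rw [hcdef, hrdef]; ring)
    rw [hp] at e
    rw [← e]
    refine setLIntegral_congr_fun measurableSet_Ioo fun x hx => ?_
    have hxm : x + c ∈ Ioo a b := by constructor <;> linarith [hx.1, hx.2]
    have hmin : min (x + c - a) (b - (x + c)) = r - |x| := by
      rcases le_total 0 x with h | h
      · rw [abs_of_nonneg h, min_eq_right (by linarith)]; linarith
      · rw [abs_of_nonpos h, min_eq_left (by linarith)]; linarith
    have hpos : 0 ≤ r - |x| := by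
      have := abs_lt.2 hx; linarith
    rw [infD hab hxm, hmin, Real.rpow_neg hpos, div_eq_mul_inv]
  · rw [← lintegral_add_right_eq_self
      (fun x => ∫⁻ y, ENNReal.ofReal |(|u x|) - (|u y|)| * kk s (x - y)) c]
    refine lintegral_congr fun x => ?_
    rw [← lintegral_add_right_eq_self
      (fun y => ENNReal.ofReal |(|u (x + c)|) - (|u y|)| * kk s (x + c - y)) c]
    refine lintegral_congr fun y => ?_
    have h3 : x + c - (y + c) = x - y := by ring
    rw [h3]

lemma gag_scale {s c : ℝ} (hc : 0 ≤ c) (u : ℝ → ℝ) :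
    gagliardo1 s 1 univ (fun x => c * u x) = ENNReal.ofReal c * gagliardo1 s 1 univ u := by
  rw [gag_eq, gag_eq, ← lintegral_const_mul' _ _ ENNReal.ofReal_ne_top]
  refine lintegral_congr fun x => ?_
  rw [← lintegral_const_mul' _ _ ENNReal.ofReal_ne_top]
  refine lintegral_congr fun y => ?_
  rw [← mul_assoc, ← ENNReal.ofReal_mul hc, ← mul_sub, abs_mul, abs_of_nonneg hc]

lemma hardy_le {s a b N : ℝ} {Ω : Set ℝ} (hs : 0 < s) (hs1 : s < 1) (hab : a < b) (hsub : Ioo a b ⊆ Ω)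
    (hΩ : MeasurableSet Ω) (hN : 0 < N)
    (hI : ∫⁻ x in Ioo a b, ENNReal.ofReal (1 / infDist x (frontier Ω) ^ s) = ENNReal.ofReal N) :
    hardyConst1 s 1 Ω ≤ ENNReal.ofReal (4 * (b - a) ^ (1 - s) / (s * (1 - s)) / N) := by
  set S := Real.smoothTransition with hS
  have Sm : Monotone S := Real.smoothTransition.monotone
  have Sc : Continuous S := Real.smoothTransition.continuous
  set W : ℝ → ℝ := fun x => 1 / infDist x (frontier Ω) ^ s with hW
  have hW0 : ∀ x, 0 ≤ W x := fun x => div_nonneg zero_le_one (Real.rpow_nonneg infDist_nonneg _)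
  have mW : Measurable W := by
    have : Measurable fun x => infDist x (frontier Ω) := (continuous_infDist_pt _).measurable
    simp only [hW]; fun_prop
  have hWi : IntegrableOn W (Ioo a b) := by
    refine ⟨mW.aestronglyMeasurable, ?_⟩
    rw [hasFiniteIntegral_iff_ofReal (ae_of_all _ hW0), hI]
    exact ENNReal.ofReal_lt_top
  have hWN : ∫ x in Ioo a b, W x = N := by
    have := ofReal_integral_eq_lintegral_ofReal hWi (ae_of_all _ hW0)
    rw [hI] at this
    exact (ENNReal.ofReal_eq_ofReal_iff (integral_nonneg hW0) hN.le).1 this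
  set A : ℕ → ℝ → ℝ := fun n x => S ((x - a) * n - 1) with hA
  set B : ℕ → ℝ → ℝ := fun n x => S ((x - b) * n + 2) with hB
  set u : ℕ → ℝ → ℝ := fun n x => A n x - B n x with hu
  have hAB : ∀ n x, |u n x| ≤ 1 := by
    intro n x
    have h1 := Real.smoothTransition.nonneg ((x - a) * n - 1)
    have h2 := Real.smoothTransition.le_one ((x - a) * n - 1)
    have h3 := Real.smoothTransition.nonneg ((x - b) * n + 2)
    have h4 := Real.smoothTransition.le_one ((x - b) * n + 2)
    simp only [hu, hA, hB]
    rw [abs_le]; constructor <;> linarith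
  have cu : ∀ n, Continuous (u n) := fun n => by simp only [hu, hA, hB]; fun_prop
  set Nn : ℕ → ℝ := fun n => ∫ x in Ioo a b, |u n x| * W x with hNn
  have lim : Tendsto Nn atTop (nhds N) := by
    rw [← hWN]
    refine tendsto_integral_of_dominated_convergence W ?_ hWi ?_ ?_
    · intro n; exact ((cu n).abs.measurable.mul mW).aestronglyMeasurable
    · intro n
      refine ae_of_all _ fun x => ?_
      rw [Real.norm_eq_abs, abs_mul, abs_abs, abs_of_nonneg (hW0 x)]
      exact mul_le_of_le_one_left (hW0 x) (hAB n x)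
    · refine (ae_restrict_iff' measurableSet_Ioo).2 (ae_of_all _ fun x hx => ?_)
      refine tendsto_const_nhds.congr' ?_
      have t1 : Tendsto (fun n : ℕ => (x - a) * (n:ℝ)) atTop atTop :=
        tendsto_natCast_atTop_atTop.const_mul_atTop (sub_pos.2 hx.1)
      have t2 : Tendsto (fun n : ℕ => (b - x) * (n:ℝ)) atTop atTop :=
        tendsto_natCast_atTop_atTop.const_mul_atTop (sub_pos.2 hx.2)
      filter_upwards [t1.eventually_ge_atTop 2, t2.eventually_ge_atTop 2] with n h1 h2
      have e1 : A n x = 1 := Real.smoothTransition.one_of_one_le (by linarith)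
      have e2 : B n x = 0 := Real.smoothTransition.zero_of_nonpos (by linarith)
      simp [hu, e1, e2]
  have limf : Tendsto (fun n => ENNReal.ofReal (4 * (b - a) ^ (1 - s) / (s * (1 - s)) / Nn n)) atTop
      (nhds (ENNReal.ofReal (4 * (b - a) ^ (1 - s) / (s * (1 - s)) / N))) :=
    ENNReal.tendsto_ofReal (tendsto_const_nhds.div lim hN.ne')
  refine ge_of_tendsto limf ?_
  have t3 : Tendsto (fun n : ℕ => (b - a) * (n:ℝ)) atTop atTop :=
    tendsto_natCast_atTop_atTop.const_mul_atTop (sub_pos.2 hab)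
  filter_upwards [t3.eventually_ge_atTop 3, lim.eventually (lt_mem_nhds hN), eventually_gt_atTop 0] with n h3 hNpos hn0
  have hn : (0:ℝ) < n := by exact_mod_cast hn0
  have hni : (0:ℝ) < 1 / n := by positivity
  have hnn : 1 / (n:ℝ) * n = 1 := by field_simp
  have A0 : ∀ x ≤ a + 1 / n, A n x = 0 := fun x hx => by
    refine Real.smoothTransition.zero_of_nonpos ?_
    nlinarith
  have A1 : ∀ x, a + 2 * (1 / n) ≤ x → A n x = 1 := fun x hx => by
    refine Real.smoothTransition.one_of_one_le ?_
    nlinarith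
  have B0 : ∀ x ≤ b - 2 * (1 / n), B n x = 0 := fun x hx => by
    refine Real.smoothTransition.zero_of_nonpos ?_
    nlinarith
  have B1 : ∀ x, b - 1 / n ≤ x → B n x = 1 := fun x hx => by
    refine Real.smoothTransition.one_of_one_le ?_
    nlinarith
  have hgap : a + 3 * (1 / n) ≤ b := by
    by_contra hcon
    push Not at hcon
    nlinarith
  have u0 : ∀ x, x ∉ Icc (a + 1 / n) (b - 1 / n) → u n x = 0 := by
    intro x hx
    rw [mem_Icc, not_and_or, not_le, not_le] at hx
    simp only [hu]
    rcases hx with hx | hx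
    · rw [A0 x hx.le, B0 x (by linarith)]; simp
    · rw [B1 x hx.le, A1 x (by linarith)]; simp
  have hIcc : Icc (a + 1 / (n:ℝ)) (b - 1 / n) ⊆ Ioo a b := fun x hx =>
    ⟨by linarith [hx.1], by linarith [hx.2]⟩
  have gu : gagliardo1 s 1 univ (u n) ≤ ENNReal.ofReal (4 * (b - a) ^ (1 - s) / (s * (1 - s))) :=
    gag_upper hs hs1 (A := A n) (B := B n) (by simp only [hA]; fun_prop)
      (fun x y hxy => Sm (by nlinarith)) (by simp only [hB]; fun_prop)
      (fun x y hxy => Sm (by nlinarith)) (fun x => rfl) (p := a + 1 / n) (q := a + 2 * (1 / n))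
      (p' := b - 2 * (1 / n)) (q' := b - 1 / n) (by linarith) (by linarith) hab A0 A1 B0 B1 (hAB n)
      (fun x hx => u0 x fun h => hx (hIcc h))
  have hts : tsupport (fun x => (Nn n)⁻¹ * u n x) ⊆ Icc (a + 1 / (n:ℝ)) (b - 1 / n) := by
    refine closure_minimal ?_ isClosed_Icc
    intro x hx
    by_contra hcon
    exact hx (by simp [u0 x hcon])
  calc hardyConst1 s 1 Ω ≤ gagliardo1 s 1 univ (fun x => (Nn n)⁻¹ * u n x) := by
        refine sInf_le ⟨fun x => (Nn n)⁻¹ * u n x, ?_, ?_, ?_, ?_, rfl⟩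
        · have hSd : ContDiff ℝ (⊤ : ℕ∞) S := Real.smoothTransition.contDiff
          refine contDiff_const.mul (ContDiff.sub ?_ ?_)
          · exact hSd.comp (((contDiff_id.sub contDiff_const).mul contDiff_const).sub contDiff_const)
          · exact hSd.comp (((contDiff_id.sub contDiff_const).mul contDiff_const).add contDiff_const)
        · exact isCompact_Icc.of_isClosed_subset (isClosed_tsupport _) hts
        · exact (hts.trans hIcc).trans hsub
        · simp only [Real.rpow_one, mul_one]
          rw [setIntegral_eq_of_subset_of_forall_sdiff_eq_zero hΩ hsub]
          · have : ∀ x, |(Nn n)⁻¹ * u n x| / infDist x (frontier Ω) ^ s = (Nn n)⁻¹ * (|u n x| * W x) := by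
              intro x
              rw [abs_mul, abs_of_pos (inv_pos.2 hNpos)]; simp only [hW]; ring
            simp_rw [this]
            rw [integral_const_mul]
            exact inv_mul_cancel₀ hNpos.ne'
          · intro x hx
            rw [u0 x fun h => hx.2 (hIcc h)]; simp
    _ = ENNReal.ofReal (Nn n)⁻¹ * gagliardo1 s 1 univ (u n) := gag_scale (inv_pos.2 hNpos).le _
    _ ≤ ENNReal.ofReal (Nn n)⁻¹ * ENNReal.ofReal (4 * (b - a) ^ (1 - s) / (s * (1 - s))) := by gcongr
    _ = _ := by
        rw [← ENNReal.ofReal_mul (inv_pos.2 hNpos).le, div_eq_mul_inv _ (Nn n), mul_comm]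

lemma wt {s L : ℝ} (hs1 : s < 1) {a : ℝ} (hL : 0 < L) :
    ∫⁻ x in Ioo a (a + L), ENNReal.ofReal (1 / (x - a) ^ s) = ENNReal.ofReal (L ^ (1 - s) / (1 - s)) := by
  have h1 : 0 < 1 - s := by linarith
  have := lint_Ioo (a := a) (b := a + L) (g := fun x => (x - a) ^ (1 - s) / (1 - s)) (g' := fun x => 1 / (x - a) ^ s)
    (by linarith)
    (by
      refine ContinuousOn.div_const ?_ _
      exact (continuousOn_id.sub continuousOn_const).rpow_const fun x _ => Or.inr h1.le)
    (by
      intro x hx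
      have hx0 : 0 < x - a := sub_pos.2 hx.1
      have := (((hasDerivAt_id x).sub_const a).rpow_const (p := 1 - s) (Or.inl hx0.ne')).div_const (1 - s)
      refine this.congr_deriv ?_
      have h2 : 1 - s - 1 = -s := by ring
      rw [h2]; simp only [id]; rw [Real.rpow_neg hx0.le]; field_simp)
    (fun x hx => by have := sub_pos.2 hx.1; positivity)
  rw [this]
  simp [Real.zero_rpow h1.ne']

lemma half_le {s : ℝ} (hs : 0 < s) (hs1 : s < 1) : hardyConst1 s 1 (Ioi 0) ≤ ENNReal.ofReal (4 / s) := by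
  have h1 : 0 < 1 - s := by linarith
  have := hardy_le (N := 1 / (1 - s)) hs hs1 (zero_lt_one) (Ioo_subset_Ioi_self : Ioo (0:ℝ) 1 ⊆ Ioi 0)
    measurableSet_Ioi (by positivity) (by
      have := wt (s := s) (L := 1) (a := 0) hs1 one_pos
      simp only [zero_add, Real.one_rpow, sub_zero] at this
      rw [← this]
      refine setLIntegral_congr_fun measurableSet_Ioo fun x hx => ?_
      simp only [infD' hx.1])
  refine this.trans (le_of_eq ?_)
  congr 1
  simp only [sub_zero, Real.one_rpow]
  field_simp

lemma int_le {s a b : ℝ} (hs : 0 < s) (hs1 : s < 1) (hab : a < b) :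
    hardyConst1 s 1 (Ioo a b) ≤ ENNReal.ofReal (2 ^ (2 - s) / s) := by
  have h1 : 0 < 1 - s := by linarith
  obtain ⟨r, hr, rfl⟩ : ∃ r, 0 < r ∧ b = a + 2 * r := ⟨(b - a) / 2, by linarith, by ring⟩
  have := hardy_le (N := 2 * (r ^ (1 - s) / (1 - s))) hs hs1 hab (subset_refl _)
    measurableSet_Ioo (by positivity) (by
      have hu : Ioo a (a + 2 * r) = Ioc a (a + r) ∪ Ioo (a + r) (a + 2 * r) :=
        (Ioc_union_Ioo_eq_Ioo (by linarith) (by linarith)).symm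
      have hd : Disjoint (Ioc a (a + r)) (Ioo (a + r) (a + 2 * r)) := by
        rw [Set.disjoint_left]; intro x hx hx'; linarith [hx.2, hx'.1]
      have i1 : ∫⁻ x in Ioc a (a + r), ENNReal.ofReal (1 / infDist x (frontier (Ioo a (a + 2 * r))) ^ s) =
          ENNReal.ofReal (r ^ (1 - s) / (1 - s)) := by
        rw [← setLIntegral_congr Ioo_ae_eq_Ioc, ← wt (a := a) hs1 hr]
        refine setLIntegral_congr_fun measurableSet_Ioo fun x hx => ?_
        rw [infD hab ⟨hx.1, by linarith [hx.2]⟩, min_eq_left (by linarith [hx.2])]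
      have i2 : ∫⁻ x in Ioo (a + r) (a + 2 * r), ENNReal.ofReal (1 / infDist x (frontier (Ioo a (a + 2 * r))) ^ s) =
          ENNReal.ofReal (r ^ (1 - s) / (1 - s)) := by
        rw [← wt (a := -(a + 2 * r)) hs1 hr]
        have e := (Measure.measurePreserving_neg (volume : Measure ℝ)).setLIntegral_comp_preimage_emb
          (MeasurableEquiv.neg ℝ).measurableEmbedding
          (fun x => ENNReal.ofReal (1 / (x - -(a + 2 * r)) ^ s)) (Ioo (-(a + 2 * r)) (-(a + 2 * r) + r))
        rw [← e]
        have hp : (Neg.neg : ℝ → ℝ) ⁻¹' Ioo (-(a + 2 * r)) (-(a + 2 * r) + r) = Ioo (a + r) (a + 2 * r) := by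
          ext x; simp only [mem_preimage, mem_Ioo]
          constructor <;> intro h <;> constructor <;> linarith [h.1, h.2]
        rw [hp]
        refine setLIntegral_congr_fun measurableSet_Ioo fun x hx => ?_
        rw [infD hab ⟨by linarith [hx.1], hx.2⟩, min_eq_right (by linarith [hx.1])]
        congr 3; ring
      nth_rewrite 1 [hu]
      rw [lintegral_union measurableSet_Ioo hd, i1, i2, ← ENNReal.ofReal_add (by positivity) (by positivity)]
      congr 1; ring)
  refine this.trans (le_of_eq ?_)
  congr 1
  have e1 : a + 2 * r - a = 2 * r := by ring
  have e2 : (2:ℝ) - s = (1 - s) + 1 := by ring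
  rw [e1, Real.mul_rpow (by norm_num) hr.le, e2, Real.rpow_add_one (by norm_num)]
  have : 0 < r ^ (1 - s) := by positivity
  field_simp
  ring

lemma exists_Ioo {Ω : Set ℝ} (hne : Ω.Nonempty) (hop : IsOpen Ω)
    (hconv : Convex ℝ Ω) (hbd : Bornology.IsBounded Ω) : ∃ a b, a < b ∧ Ω = Ioo a b := by
  have hsub : Ω ⊆ Ioo (sInf Ω) (sSup Ω) := by
    intro x hx
    obtain ⟨ε, hε, hb⟩ := Metric.isOpen_iff.1 hop x hx
    constructor
    · have := csInf_le hbd.bddBelow (hb (show x - ε / 2 ∈ ball x ε by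
        rw [mem_ball, Real.dist_eq, abs_lt]; constructor <;> linarith))
      linarith
    · have := le_csSup hbd.bddAbove (hb (show x + ε / 2 ∈ ball x ε by
        rw [mem_ball, Real.dist_eq, abs_lt]; constructor <;> linarith))
      linarith
  obtain ⟨x, hx⟩ := hne
  refine ⟨sInf Ω, sSup Ω, (hsub hx).1.trans (hsub hx).2, subset_antisymm hsub ?_⟩
  exact IsConnected.Ioo_csInf_csSup_subset ⟨⟨x, hx⟩, hconv.isPreconnected⟩ hbd.bddBelow hbd.bddAbove

/-- for a nonempty bounded convex open `Ω ⊊ ℝ` and `s ∈ (0,1)`,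
`𝔥_{s,1}(Ω) = 2^{2-s}/s`, equivalently `𝔥_{s,1}(Ω) = 2^{-s}·𝔥_{s,1}((0,∞))`. -/
theorem hardy_interval_eq (Ω : Set ℝ) (hne : Ω.Nonempty) (hop : IsOpen Ω)
    (hconv : Convex ℝ Ω) (hbd : Bornology.IsBounded Ω)
    (s : ℝ) (hs : s ∈ Set.Ioo (0 : ℝ) 1) :
    hardyConst1 s 1 Ω = ENNReal.ofReal (2 ^ (2 - s) / s) ∧
      hardyConst1 s 1 Ω = ENNReal.ofReal ((2 : ℝ) ^ (-s)) * hardyConst1 s 1 (Set.Ioi 0) := by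
  obtain ⟨a, b, hab, rfl⟩ := exists_Ioo hne hop hconv hbd
  obtain ⟨hs0, hs1⟩ := hs
  have e1 : hardyConst1 s 1 (Ioo a b) = ENNReal.ofReal (2 ^ (2 - s) / s) :=
    le_antisymm (int_le hs0 hs1 hab) (int_ge hs0 hs1 hab)
  have e2 : hardyConst1 s 1 (Ioi 0) = ENNReal.ofReal (4 / s) :=
    le_antisymm (half_le hs0 hs1) (half_ge hs0)
  refine ⟨e1, ?_⟩
  rw [e1, e2, ← ENNReal.ofReal_mul (by positivity)]
  congr 1
  rw [sub_eq_neg_add, Real.rpow_add (by norm_num)]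
  norm_num
  ring
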